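/- Let n ≥ 2, q ∈ [0,n), λ > 0 and h > 0. There exists a constant C, depending only on n, q and λ, with the following property. Let O ⊆ ℝⁿ be a bounded open convex set and let w : O̅ → ℝ be continuous and convex with w > 0 in O and w ≤ h on ∂O, and suppose that |∂w(E)| ≥ λ ∫_E w^q dx for every Borel set E ⊆ O, where ∂w is the subdifferential of w relative to O. Then |O| ≤ C h^{(n−q)/2}. -/

import Mathlib

open MeasureTheory Set Metric
open scoped RealInnerProductSpace

noncomputable section

/-- The subdifferential of a convex function `v` at `x`, relative to the domain `Ω`. -/
def subgrad {n : ℕ} (Ω : Set (EuclideanSpace ℝ (Fin n))) (v : EuclideanSpace ℝ (Fin n) → ℝ)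
    (x : EuclideanSpace ℝ (Fin n)) : Set (EuclideanSpace ℝ (Fin n)) :=
  {p | ∀ y ∈ Ω, v x + ⟪p, y - x⟫ ≤ v y}

/-- The image `∂v(E) = ⋃_{x ∈ E} ∂v(x)` of a set under the subdifferential. -/
def subgradImg {n : ℕ} (Ω : Set (EuclideanSpace ℝ (Fin n))) (v : EuclideanSpace ℝ (Fin n) → ℝ)
    (E : Set (EuclideanSpace ℝ (Fin n))) : Set (EuclideanSpace ℝ (Fin n)) :=
  ⋃ x ∈ E, subgrad Ω v x

/-- The last coordinate `x_n` of a point of `ℝⁿ`. -/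
def lastCoord {n : ℕ} (x : EuclideanSpace ℝ (Fin n)) : ℝ :=
  if h : 0 < n then x ⟨n - 1, by omega⟩ else 0

/-- The first `n-1` coordinates `x'` of a point of `ℝⁿ`. -/
def fstCoords {n : ℕ} (x : EuclideanSpace ℝ (Fin n)) : EuclideanSpace ℝ (Fin (n - 1)) :=
  (EuclideanSpace.equiv (Fin (n - 1)) ℝ).symm
    (fun i => x ⟨i, lt_of_lt_of_le i.isLt (Nat.sub_le n 1)⟩)

/-- The point `(x', t) ∈ ℝⁿ = ℝ^{n-1} × ℝ`. -/
def app (n : ℕ) (x' : EuclideanSpace ℝ (Fin (n - 1))) (t : ℝ) : EuclideanSpace ℝ (Fin n) :=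
  (EuclideanSpace.equiv (Fin n) ℝ).symm
    (fun i => if h : (i : ℕ) < n - 1 then x' ⟨i, h⟩ else t)

/-- The closed cube of half-side `s` about the origin of `ℝⁿ`. -/
def box (n : ℕ) (s : ℝ) : Set (EuclideanSpace ℝ (Fin n)) := {c | ∀ i, |c i| ≤ s}

theorem box_eq_preimage (n : ℕ) {s : ℝ} (hs : 0 ≤ s) :
    box n s = (WithLp.ofLp : EuclideanSpace ℝ (Fin n) → Fin n → ℝ) ⁻¹' closedBall 0 s := by
  ext c
  simp [box, pi_norm_le_iff_of_nonneg hs]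

theorem volume_box (n : ℕ) {s : ℝ} (hs : 0 ≤ s) :
    volume (box n s) = ENNReal.ofReal ((2 * s) ^ n) := by
  rw [box_eq_preimage n hs, (PiLp.volume_preserving_ofLp (Fin n)).measure_preimage
    measurableSet_closedBall.nullMeasurableSet, Real.volume_pi_closedBall _ hs, Fintype.card_fin]

theorem isCompact_box (n : ℕ) {s : ℝ} (hs : 0 ≤ s) : IsCompact (box n s) := by
  rw [box_eq_preimage n hs]
  exact (PiLp.homeomorph 2 (fun _ : Fin n => ℝ)).isCompact_preimage.2 (isCompact_closedBall 0 s)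

theorem neg_mem_box {n : ℕ} {s : ℝ} {c : EuclideanSpace ℝ (Fin n)} (hc : c ∈ box n s) :
    -c ∈ box n s := fun i => by simpa using hc i

theorem add_mem_box {n : ℕ} {s t r : ℝ} {c d : EuclideanSpace ℝ (Fin n)} (hc : c ∈ box n s)
    (hd : d ∈ box n t) (h : s + t ≤ r) : c + d ∈ box n r := fun i =>
  (abs_add_le _ _).trans ((add_le_add (hc i) (hd i)).trans h)

theorem zero_mem_box (n : ℕ) {s : ℝ} (hs : 0 ≤ s) : (0 : EuclideanSpace ℝ (Fin n)) ∈ box n s :=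
  fun i => by simpa using hs

theorem det_toEuclideanLin {n : ℕ} (M : Matrix (Fin n) (Fin n) ℝ) :
    LinearMap.det (Matrix.toEuclideanLin M) = M.det := by
  have h : Matrix.toEuclideanLin M = Matrix.toLpLin 2 2 M := rfl
  rw [h, Matrix.toLpLin_eq_toLin, LinearMap.det_toLin]

theorem det_adjoint_toEuclideanLin {n : ℕ} (M : Matrix (Fin n) (Fin n) ℝ) :
    LinearMap.det (Matrix.toEuclideanLin M).adjoint = M.det := by
  rw [← Matrix.toEuclideanLin_conjTranspose_eq_adjoint, det_toEuclideanLin]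
  simp

/-- A bounded open convex set contains a parallelepiped of comparable volume; it comes from a
simplex of maximal volume with vertices in the closure. -/
theorem exists_affine_box {n : ℕ} (hn : 0 < n) {O : Set (EuclideanSpace ℝ (Fin n))}
    (hO : IsOpen O) (hconv : Convex ℝ O) (hbd : Bornology.IsBounded O) (hne : O.Nonempty) :
    ∃ (g : EuclideanSpace ℝ (Fin n)) (M : Matrix (Fin n) (Fin n) ℝ), M.det ≠ 0 ∧
      (∀ c ∈ box n (1 / (4 * n)), g + Matrix.toEuclideanLin M c ∈ O) ∧
      volume O ≤ ENNReal.ofReal (2 ^ n * |M.det|) := by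
  have hnR : (0 : ℝ) < n := by exact_mod_cast hn
  have hK : IsCompact (closure O) := hbd.isCompact_closure
  let A : EuclideanSpace ℝ (Fin n) × (Fin n → EuclideanSpace ℝ (Fin n)) →
    Matrix (Fin n) (Fin n) ℝ := fun z => Matrix.of fun j i => z.2 i j - z.1 j
  have hAc : Continuous A := by
    refine continuous_matrix fun i j => ?_
    simp only [A, Matrix.of_apply]
    fun_prop
  have hS : IsCompact (closure O ×ˢ (Set.univ.pi fun _ : Fin n => closure O)) :=
    hK.prod (isCompact_univ_pi fun _ => hK)
  obtain ⟨z, hz⟩ := hne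
  obtain ⟨⟨x₀, x⟩, ⟨hx₀, hx⟩, hmax⟩ := hS.exists_isMaxOn
    ⟨(z, fun _ => z), subset_closure hz, fun _ _ => subset_closure hz⟩
    (f := fun z => |(A z).det|) (hAc.matrix_det.abs.continuousOn)
  simp only [mem_univ, Set.mem_pi, forall_const] at hx
  set M := A (x₀, x) with hM
  have hMx : ∀ i, Matrix.toEuclideanLin M (EuclideanSpace.single i 1) = x i - x₀ := by
    intro i
    ext j
    simp [Matrix.toLpLin_apply, hM, A]
  have hdet : M.det ≠ 0 := by
    obtain ⟨ε, hε, hball⟩ := Metric.isOpen_iff.1 hO z hz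
    have hmem : ∀ i, z + EuclideanSpace.single i (ε / 2) ∈ closure O := fun i =>
      subset_closure (hball (by simp [abs_of_pos hε]; linarith))
    have h1 := hmax (show (z, fun i => z + EuclideanSpace.single i (ε / 2)) ∈
      closure O ×ˢ (Set.univ.pi fun _ : Fin n => closure O) from
      ⟨subset_closure hz, fun i _ => hmem i⟩)
    have h2 : A (z, fun i => z + EuclideanSpace.single i (ε / 2)) =
        Matrix.diagonal fun _ => ε / 2 := by
      ext j i
      simp [A, Matrix.diagonal_apply, PiLp.single_apply]
    simp only [mem_ofPred_eq] at h1
    rw [h2, Matrix.det_diagonal] at h1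
    intro h0
    rw [← hM, h0] at h1
    simp at h1
    exact absurd h1.1 hε.ne'
  have hcombo : ∀ a : Fin n → ℝ, (∀ i, 0 ≤ a i) → ∑ i, a i ≤ 1 →
      x₀ + Matrix.toEuclideanLin M (WithLp.toLp 2 a) ∈ closure O := by
    intro a ha hs
    have h1 : Matrix.toEuclideanLin M (WithLp.toLp 2 a) = ∑ i, a i • (x i - x₀) := by
      have : (WithLp.toLp 2 a : EuclideanSpace ℝ (Fin n)) =
          ∑ i, a i • EuclideanSpace.single i (1 : ℝ) := by
        ext j
        simp [Finset.sum_apply, Pi.single_apply]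
      rw [this, map_sum]
      simp only [map_smul, hMx]
    have h2 : x₀ + ∑ i, a i • (x i - x₀) = (1 - ∑ i, a i) • x₀ + ∑ i, a i • x i := by
      simp only [smul_sub, Finset.sum_sub_distrib, ← Finset.sum_smul, sub_smul, one_smul]
      abel
    rw [h1, h2]
    have h3 := hconv.closure.sum_mem (t := Finset.univ)
      (w := fun o : Option (Fin n) => o.elim (1 - ∑ i, a i) a)
      (z := fun o : Option (Fin n) => o.elim x₀ x)
      (by rintro (_ | i) - <;> simp [ha, hs])
      (by simp [Fintype.sum_option])
      (by rintro (_ | i) - <;> simp [hx₀, hx])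
    simpa [Fintype.sum_option] using h3
  set T := Matrix.toEuclideanLin M with hT
  have hTdet : LinearMap.det T = M.det := det_toEuclideanLin M
  refine ⟨x₀ + T (WithLp.toLp 2 fun _ => 1 / (2 * n)), M, hdet, ?_, ?_⟩
  · set g := x₀ + T (WithLp.toLp 2 fun _ => 1 / (2 * n)) with hg
    have hbig : (fun c => g + T c) '' box n (1 / (2 * n)) ⊆ closure O := by
      rintro _ ⟨c, hc, rfl⟩
      have : g + T c = x₀ + T (WithLp.toLp 2 fun i => 1 / (2 * n) + c i) := by
        rw [hg, add_assoc, ← map_add]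
        congr 2
      simp only
      rw [this]
      refine hcombo _ (fun i => by linarith [(abs_le.1 (hc i)).1]) ?_
      calc ∑ i, (1 / (2 * (n : ℝ)) + c i) ≤ ∑ _i : Fin n, 1 / (n : ℝ) :=
            Finset.sum_le_sum fun i _ => by
              have := (abs_le.1 (hc i)).2
              have e : 1 / (n : ℝ) = 1 / (2 * n) + 1 / (2 * n) := by field_simp; norm_num
              linarith
        _ = 1 := by simp [hnR.ne']
    intro c hc
    have hint : interior (closure O) = O := by
      rw [hconv.interior_closure_eq_interior_of_nonempty_interior
        (by rw [hO.interior_eq]; exact ⟨z, hz⟩), hO.interior_eq]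
    rw [← hint]
    let L : EuclideanSpace ℝ (Fin n) ≃L[ℝ] EuclideanSpace ℝ (Fin n) :=
      (LinearMap.equivOfDetNeZero T (by rwa [hTdet])).toContinuousLinearEquiv
    let U : Set (EuclideanSpace ℝ (Fin n)) := {c | ∀ i, |c i| < 1 / (2 * n)}
    have hU : IsOpen U := by
      simp only [U, ofPred_forall]
      refine isOpen_iInter_of_finite fun i => isOpen_lt ?_ continuous_const
      fun_prop
    have hopen : IsOpen ((fun c => g + T c) '' U) := by
      have := (L.toHomeomorph.trans (Homeomorph.addLeft g)).isOpenMap U hU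
      exact this
    have hUbox : U ⊆ box n (1 / (2 * n)) := fun c hc i => (hc i).le
    refine interior_maximal ((image_mono hUbox).trans hbig) hopen
      ⟨c, fun i => (hc i).trans_lt ?_, rfl⟩
    exact one_div_lt_one_div_of_lt (by positivity) (by linarith)
  · have hsub : O ⊆ (fun y => x₀ + y) '' (T '' box n 1) := by
      intro y hy
      have hc : ∀ i, |(M.updateCol i fun j => y j - x₀ j).det| ≤ |M.det| := by
        intro i
        have h1 := hmax (show (x₀, Function.update x i y) ∈
          closure O ×ˢ (Set.univ.pi fun _ : Fin n => closure O) from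
          ⟨hx₀, fun k _ => by
            by_cases hk : k = i
            · subst hk; simpa using subset_closure hy
            · simpa [hk] using hx k⟩)
        have h2 : A (x₀, Function.update x i y) = M.updateCol i fun j => y j - x₀ j := by
          ext j k
          by_cases hk : k = i
          · subst hk; simp [A]
          · simp [A, hM, hk]
        simpa only [mem_ofPred_eq, h2] using h1
      refine ⟨y - x₀, ⟨WithLp.toLp 2 (M.det⁻¹ • M.cramer fun j => y j - x₀ j), ?_, ?_⟩, by simp⟩
      · intro i
        simp only [Pi.smul_apply, smul_eq_mul, Matrix.cramer_apply, abs_mul, abs_inv]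
        rw [inv_mul_le_iff₀ (abs_pos.2 hdet), mul_one]
        exact hc i
      · rw [hT, Matrix.toLpLin_apply, Matrix.mulVec_smul, Matrix.mulVec_cramer, smul_smul,
          inv_mul_cancel₀ hdet, one_smul]
        ext j
        simp
    refine (measure_mono hsub).trans ?_
    rw [image_add_left, measure_preimage_add, Measure.addHaar_image_linearMap, hTdet,
      volume_box n zero_le_one, ← ENNReal.ofReal_mul (abs_nonneg _), mul_one, mul_comm]

/-- A continuous convex function on the closure of a bounded open convex set is bounded by its
boundary values. -/
theorem ConvexOn.le_of_le_frontier {E : Type*} [NormedAddCommGroup E] [NormedSpace ℝ E]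
    [Nontrivial E] [ProperSpace E] {O : Set E} {w : E → ℝ} {h : ℝ} (hO : IsOpen O)
    (hbd : Bornology.IsBounded O) (hcont : ContinuousOn w (closure O))
    (hw : ConvexOn ℝ (closure O) w) (hfr : ∀ x ∈ frontier O, w x ≤ h) :
    ∀ x ∈ closure O, w x ≤ h := by
  intro x hx
  obtain ⟨z, hz, hmax⟩ := hbd.isCompact_closure.exists_isMaxOn ⟨x, hx⟩ hcont
  refine (hmax hx).trans ?_
  by_contra! hlt
  have hzO : z ∈ O := by
    by_contra hzO
    exact hlt.not_ge (hfr z (by rw [hO.frontier_eq]; exact ⟨hz, hzO⟩))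
  have hne : O ≠ univ := fun h => NormedSpace.unbounded_univ ℝ E (h ▸ hbd)
  obtain ⟨y, hy⟩ := nonempty_frontier_iff.2 ⟨⟨z, hzO⟩, hne⟩
  have hlim : ∀ᶠ ε : ℝ in nhdsWithin 0 (Ioi 0), z + ε • (z - y) ∈ O := by
    have hc : ContinuousAt (fun ε : ℝ => z + ε • (z - y)) 0 := by fun_prop
    exact (hc.eventually (hO.mem_nhds (by simpa using hzO))).filter_mono nhdsWithin_le_nhds
  obtain ⟨ε, hε, hpos⟩ := (hlim.and self_mem_nhdsWithin).exists
  have hpos : 0 < ε := hpos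
  have hne1 : 1 + ε ≠ 0 := by positivity
  have hconv := hw.2 (frontier_subset_closure hy) (subset_closure hε)
    (show 0 ≤ ε / (1 + ε) by positivity) (show 0 ≤ 1 / (1 + ε) by positivity) (by field_simp; ring)
  have hpt : (ε / (1 + ε)) • y + (1 / (1 + ε)) • (z + ε • (z - y)) = z := by
    match_scalars <;> field_simp <;> ring
  rw [hpt, smul_eq_mul, smul_eq_mul] at hconv
  have h1 : w y < w z := (hfr y hy).trans_lt hlt
  have h2 : w (z + ε • (z - y)) ≤ w z := hmax (subset_closure hε)
  have h3 : ε / (1 + ε) * w y < ε / (1 + ε) * w z := by gcongr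
  have h4 : 1 / (1 + ε) * w (z + ε • (z - y)) ≤ 1 / (1 + ε) * w z := by gcongr
  have h5 : ε / (1 + ε) * w z + 1 / (1 + ε) * w z = w z := by field_simp; ring
  linarith

/-- A scale at which a function, trapped between two positive constants, satisfies a doubling
bound together with a power bound. -/
theorem exists_doubling_scale {m : ℝ → ℝ} {a h R α : ℝ} (ha : 0 < a) (hR : 0 < R)
    (hα : 0 < α) (hm : ∀ t ∈ Ioc 0 R, a ≤ m t ∧ m t ≤ h) :
    ∃ t ∈ Ioc 0 R, m t ≤ 2 * h / R ^ α * t ^ α ∧ m t ≤ 2 ^ (α + 1) * m (t / 2) := by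
  set S := (fun t => m t / t ^ α) '' Ioc 0 R with hS
  have hlow : ∀ y ∈ S, a / R ^ α ≤ y := by
    rintro _ ⟨t, ht, rfl⟩
    have h1 : t ^ α ≤ R ^ α := Real.rpow_le_rpow ht.1.le ht.2 hα.le
    have h2 : 0 < t ^ α := Real.rpow_pos_of_pos ht.1 _
    exact div_le_div₀ (ha.le.trans (hm t ht).1) (hm t ht).1 h2 h1
  have hRS : m R / R ^ α ∈ S := ⟨R, ⟨hR, le_rfl⟩, rfl⟩
  have hbdd : BddBelow S := ⟨_, hlow⟩
  have hRα : 0 < R ^ α := Real.rpow_pos_of_pos hR _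
  have hI : 0 < sInf S := (div_pos ha hRα).trans_le (le_csInf ⟨_, hRS⟩ hlow)
  obtain ⟨_, ⟨t, ht, rfl⟩, hlt⟩ := exists_lt_of_csInf_lt ⟨_, hRS⟩
    (show sInf S < 2 * sInf S by linarith)
  have htα : 0 < t ^ α := Real.rpow_pos_of_pos ht.1 _
  rw [div_lt_iff₀ htα] at hlt
  refine ⟨t, ht, hlt.le.trans ?_, hlt.le.trans ?_⟩
  · have h1 : sInf S ≤ h / R ^ α := (csInf_le hbdd hRS).trans
      (div_le_div_of_nonneg_right (hm R ⟨hR, le_rfl⟩).2 hRα.le)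
    rw [mul_div_assoc]
    gcongr
  · have ht2 : t / 2 ∈ Ioc 0 R := ⟨by linarith [ht.1], by linarith [ht.1, ht.2]⟩
    have h1 : sInf S ≤ m (t / 2) / (t / 2) ^ α := csInf_le hbdd ⟨_, ht2, rfl⟩
    have h2 : (0 : ℝ) < 2 ^ α := by positivity
    rw [Real.div_rpow ht.1.le zero_le_two, div_div_eq_mul_div, le_div_iff₀ htα] at h1
    rw [Real.rpow_add_one two_ne_zero]
    linarith

/-- For a function that is midpoint-bounded below on a symmetric set, half of the lower bound
survives integration. -/
theorem mul_measure_le_two_mul_setLIntegral {E : Type*} [NormedAddCommGroup E]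
    [MeasurableSpace E] [BorelSpace E] (μ : Measure E) [μ.IsNegInvariant] {K : Set E}
    (hK : MeasurableSet K) (hneg : ∀ y ∈ K, -y ∈ K) {f : E → ENNReal}
    (hf : AEMeasurable f (μ.restrict K)) {a : ENNReal} (ha : ∀ y ∈ K, a ≤ f y + f (-y)) :
    a * μ K ≤ 2 * ∫⁻ y in K, f y ∂μ := by
  have hpre : Neg.neg ⁻¹' K = K := by
    ext y
    exact ⟨fun hy => by simpa using hneg _ hy, hneg y⟩
  have hsymm : ∫⁻ y in K, f (-y) ∂μ = ∫⁻ y in K, f y ∂μ := by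
    conv_lhs => rw [← hpre]
    exact (Measure.measurePreserving_neg μ).setLIntegral_comp_preimage_emb
      (Homeomorph.neg E).measurableEmbedding f K
  calc a * μ K = ∫⁻ _ in K, a ∂μ := (setLIntegral_const K a).symm
    _ ≤ ∫⁻ y in K, f y + f (-y) ∂μ := setLIntegral_mono' hK ha
    _ = ∫⁻ y in K, f y ∂μ + ∫⁻ y in K, f (-y) ∂μ := lintegral_add_left' hf _
    _ = 2 * ∫⁻ y in K, f y ∂μ := by rw [hsymm, two_mul]

/-- Upper bound for the subgradient image of a parallelepiped inside the domain. -/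
theorem volume_subgradImg_le {n : ℕ} {O : Set (EuclideanSpace ℝ (Fin n))}
    {w : EuclideanSpace ℝ (Fin n) → ℝ} {g : EuclideanSpace ℝ (Fin n)}
    {M : Matrix (Fin n) (Fin n) ℝ} (hM : M.det ≠ 0) {s t m : ℝ} (hst : s < t) (hm : 0 ≤ m)
    (hO : ∀ c ∈ box n t, g + Matrix.toEuclideanLin M c ∈ O) (hpos : ∀ x ∈ O, 0 ≤ w x)
    (hle : ∀ c ∈ box n t, w (g + Matrix.toEuclideanLin M c) ≤ m) :
    volume (subgradImg O w ((fun c => g + Matrix.toEuclideanLin M c) '' box n s)) ≤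
      ENNReal.ofReal (|M.det|⁻¹ * (2 * (m / (t - s))) ^ n) := by
  have hts : 0 < t - s := sub_pos.2 hst
  set T := Matrix.toEuclideanLin M with hT
  have hdet : LinearMap.det T.adjoint = M.det := det_adjoint_toEuclideanLin M
  have hsub : subgradImg O w ((fun c => g + T c) '' box n s) ⊆
      T.adjoint ⁻¹' box n (m / (t - s)) := by
    intro p hp
    simp only [subgradImg, mem_iUnion] at hp
    obtain ⟨_, ⟨c, hc, rfl⟩, hp⟩ := hp
    have hct : c ∈ box n t := fun i => (hc i).trans hst.le
    have key : ∀ d ∈ box n (t - s), ⟪p, T d⟫ ≤ m := by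
      intro d hd
      have hcd : c + d ∈ box n t := add_mem_box hc hd (by linarith)
      have h1 := hp _ (hO _ hcd)
      have h2 := hle _ hcd
      have h3 := hpos _ (hO _ hct)
      have h4 : g + T (c + d) - (g + T c) = T d := by rw [map_add]; abel
      simp only at h1
      rw [h4] at h1
      linarith
    intro i
    have hcoord : T.adjoint p i = ⟪p, T (EuclideanSpace.single i 1)⟫ := by
      rw [← LinearMap.adjoint_inner_left]
      simp [EuclideanSpace.inner_single_right]
    have hsingle : EuclideanSpace.single i (t - s) ∈ box n (t - s) := by
      intro j
      by_cases hj : j = i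
      · subst hj; simp [abs_of_pos hts]
      · simp [hj, hts.le]
    have hsm : (EuclideanSpace.single i (t - s) : EuclideanSpace ℝ (Fin n)) =
        (t - s) • EuclideanSpace.single i 1 := by
      ext j
      simp
    have h1 := key _ hsingle
    have h2 := key _ (neg_mem_box hsingle)
    rw [map_neg, inner_neg_right] at h2
    rw [hsm, map_smul, inner_smul_right, ← hcoord] at h1 h2
    rw [abs_le, le_div_iff₀ hts, ← neg_div, div_le_iff₀ hts]
    constructor <;> linarith
  refine (measure_mono hsub).trans_eq ?_
  rw [Measure.addHaar_preimage_linearMap _ (by rwa [hdet]), hdet, volume_box n (by positivity),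
    ← ENNReal.ofReal_mul (abs_nonneg _), abs_inv]

/-- Lower bound for the integral of a power of a convex function over a parallelepiped. -/
theorem rpow_mul_volume_le_setLIntegral {n : ℕ} {O : Set (EuclideanSpace ℝ (Fin n))}
    {w : EuclideanSpace ℝ (Fin n) → ℝ} {g c₀ : EuclideanSpace ℝ (Fin n)} {q : ℝ} (hq : 0 ≤ q)
    {M : Matrix (Fin n) (Fin n) ℝ} {r s : ℝ} (hrs : r ≤ s)
    (hO : ∀ c ∈ box n s, g + Matrix.toEuclideanLin M c ∈ O) (hpos : ∀ x ∈ O, 0 ≤ w x)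
    (hcont : ContinuousOn w O) (hconv : ConvexOn ℝ O w) (hc₀ : c₀ ∈ box n r) :
    ENNReal.ofReal (w (g + Matrix.toEuclideanLin M c₀) ^ q * (|M.det| * (2 * (s - r)) ^ n)) ≤
      2 * ∫⁻ x in (fun c => g + Matrix.toEuclideanLin M c) '' box n s,
        ENNReal.ofReal (w x ^ q) := by
  have hsr : 0 ≤ s - r := sub_nonneg.2 hrs
  set T := Matrix.toEuclideanLin M with hT
  have hTc : Continuous T := T.continuous_of_finiteDimensional
  set x₀ := g + T c₀ with hx₀
  set K := T '' box n (s - r) with hK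
  have hKm : MeasurableSet K := ((isCompact_box n hsr).image hTc).measurableSet
  have hshift : ∀ y ∈ K, x₀ + y ∈ (fun c => g + T c) '' box n s := by
    rintro _ ⟨d, hd, rfl⟩
    exact ⟨c₀ + d, add_mem_box hc₀ hd (by linarith), by simp only [map_add, hx₀]; abel⟩
  have hneg : ∀ y ∈ K, -y ∈ K := by
    rintro _ ⟨d, hd, rfl⟩
    exact ⟨-d, neg_mem_box hd, map_neg _ _⟩
  have hmem : ∀ y ∈ K, x₀ + y ∈ O := by
    intro y hy
    obtain ⟨c, hc, h⟩ := hshift y hy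
    exact h ▸ hO c hc
  have hx₀O : x₀ ∈ O := by
    simpa using hmem 0 ⟨0, zero_mem_box n hsr, map_zero _⟩
  have hf : AEMeasurable (fun y => ENNReal.ofReal (w (x₀ + y) ^ q)) (volume.restrict K) := by
    have h1 : ContinuousOn (fun y => w (x₀ + y)) K :=
      hcont.comp (by fun_prop) hmem
    exact ((h1.rpow_const fun _ _ => Or.inr hq).aemeasurable hKm).ennreal_ofReal
  have hbound : ∀ y ∈ K, ENNReal.ofReal (w x₀ ^ q) ≤
      ENNReal.ofReal (w (x₀ + y) ^ q) + ENNReal.ofReal (w (x₀ + -y) ^ q) := by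
    intro y hy
    have h1 := hconv.2 (hmem y hy) (hmem _ (hneg y hy)) (by norm_num : (0 : ℝ) ≤ 1 / 2)
      (by norm_num : (0 : ℝ) ≤ 1 / 2) (by norm_num)
    have h2 : (1 / 2 : ℝ) • (x₀ + y) + (1 / 2 : ℝ) • (x₀ + -y) = x₀ := by module
    rw [h2, smul_eq_mul, smul_eq_mul] at h1
    have h0 := hpos x₀ hx₀O
    rcases le_total (w (x₀ + y)) (w (x₀ + -y)) with hle | hle
    · exact (ENNReal.ofReal_le_ofReal (Real.rpow_le_rpow h0 (by linarith) hq)).trans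
        le_add_self
    · exact (ENNReal.ofReal_le_ofReal (Real.rpow_le_rpow h0 (by linarith) hq)).trans
        le_self_add
  have hvol : volume K = ENNReal.ofReal (|M.det| * (2 * (s - r)) ^ n) := by
    rw [hK, Measure.addHaar_image_linearMap, hT, det_toEuclideanLin, volume_box n hsr,
      ← ENNReal.ofReal_mul (abs_nonneg _)]
  have htrans : ∫⁻ y in K, ENNReal.ofReal (w (x₀ + y) ^ q) =
      ∫⁻ x in (fun y => x₀ + y) '' K, ENNReal.ofReal (w x ^ q) :=
    ((measurePreserving_add_left volume x₀).setLIntegral_comp_emb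
      (MeasurableEquiv.addLeft x₀).measurableEmbedding
      (fun x => ENNReal.ofReal (w x ^ q)) K)
  have h := mul_measure_le_two_mul_setLIntegral volume hKm hneg hf hbound
  rw [hvol, ← ENNReal.ofReal_mul (Real.rpow_nonneg (hpos _ hx₀O) _), htrans] at h
  refine h.trans ?_
  gcongr
  rintro _ ⟨y, hy, rfl⟩
  exact hshift y hy

theorem sq_le_of_doubling_scale {n : ℕ} {q lam R α d t h mr mt : ℝ} (hq0 : 0 ≤ q) (hqn : q < n)
    (hlam : 0 < lam) (hR : 0 < R) (hα : α * (n - q) = 2 * n) (hd : 0 < d) (ht : 0 < t)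
    (hh : 0 < h) (hmr : 0 < mr) (hmt : 0 < mt) (hpow : mt ≤ 2 * h / R ^ α * t ^ α)
    (hdouble : mt ≤ 2 ^ (α + 1) * mr)
    (hle : lam * (mr ^ q * (d * (2 * (3 * t / 4 - t / 2)) ^ n)) ≤
      2 * (d⁻¹ * (2 * (mt / (t - 3 * t / 4))) ^ n)) :
    d ^ 2 ≤ 2 * 16 ^ n * (2 ^ (α + 1)) ^ q * (2 / R ^ α) ^ (n - q) / lam * h ^ (n - q) := by
  have hP : (0 : ℝ) < (2 ^ (α + 1)) ^ q := by positivity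
  have hRα : 0 < R ^ α := by positivity
  have htα : 0 < t ^ α := by positivity
  have hnq : 0 < n - q := sub_pos.2 hqn
  have h1 : mt ^ q ≤ (2 ^ (α + 1)) ^ q * mr ^ q := by
    rw [← Real.mul_rpow (by positivity) hmr.le]
    exact Real.rpow_le_rpow hmt.le hdouble hq0
  have h2 : mt ^ (n - q) ≤ (2 / R ^ α) ^ (n - q) * h ^ (n - q) * (t ^ n) ^ 2 := by
    have e : (t ^ α) ^ (n - q) = (t ^ n) ^ 2 := by
      rw [← Real.rpow_mul ht.le, hα, mul_comm, Real.rpow_mul ht.le, Real.rpow_natCast,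
        Real.rpow_ofNat]
    rw [← e, ← Real.mul_rpow (by positivity) hh.le, ← Real.mul_rpow (by positivity) htα.le]
    exact Real.rpow_le_rpow hmt.le (hpow.trans_eq (by ring)) hnq.le
  have h3 : mt ^ n = mt ^ q * mt ^ (n - q) := by
    rw [← Real.rpow_add hmt, add_sub_cancel, Real.rpow_natCast]
  have h4 : lam * mr ^ q * d ^ 2 * (t ^ n) ^ 2 ≤ 2 * 16 ^ n * mt ^ n := by
    have e1 : (2 * (3 * t / 4 - t / 2)) ^ n = t ^ n / 2 ^ n := by rw [← div_pow]; congr 1; ring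
    have e2 : (2 * (mt / (t - 3 * t / 4))) ^ n = 8 ^ n * mt ^ n / t ^ n := by
      rw [← mul_pow, ← div_pow]; congr 1; field_simp; norm_num
    have e3 : (16 : ℝ) ^ n = 8 ^ n * 2 ^ n := by rw [← mul_pow]; norm_num
    rw [e1, e2] at hle
    have hle' := mul_le_mul_of_nonneg_right hle (show 0 ≤ d * t ^ n * 2 ^ n by positivity)
    have e4 : lam * (mr ^ q * (d * (t ^ n / 2 ^ n))) * (d * t ^ n * 2 ^ n) =
        lam * mr ^ q * d ^ 2 * (t ^ n) ^ 2 := by field_simp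
    have e5 : 2 * (d⁻¹ * (8 ^ n * mt ^ n / t ^ n)) * (d * t ^ n * 2 ^ n) =
        2 * 16 ^ n * mt ^ n := by rw [e3]; field_simp
    rwa [e4, e5] at hle'
  have h5 : mt ^ q * (lam * d ^ 2 * (t ^ n) ^ 2) ≤
      mt ^ q * (2 * 16 ^ n * (2 ^ (α + 1)) ^ q *
        ((2 / R ^ α) ^ (n - q) * h ^ (n - q) * (t ^ n) ^ 2)) :=
    calc mt ^ q * (lam * d ^ 2 * (t ^ n) ^ 2)
        ≤ ((2 ^ (α + 1)) ^ q * mr ^ q) * (lam * d ^ 2 * (t ^ n) ^ 2) := by gcongr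
      _ = (2 ^ (α + 1)) ^ q * (lam * mr ^ q * d ^ 2 * (t ^ n) ^ 2) := by ring
      _ ≤ (2 ^ (α + 1)) ^ q * (2 * 16 ^ n * (mt ^ q * mt ^ (n - q))) := by
        rw [← h3]; gcongr
      _ = mt ^ q * (2 * 16 ^ n * (2 ^ (α + 1)) ^ q * mt ^ (n - q)) := by ring
      _ ≤ _ := by gcongr
  have h6 := le_of_mul_le_mul_left h5 (by positivity)
  rw [div_mul_eq_mul_div, le_div_iff₀ hlam]
  refine le_of_mul_le_mul_right ?_ (show 0 < (t ^ n) ^ 2 by positivity)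
  linarith

/-- **Volume bound for sublevel domains** (Lemma 2.4): if `w > 0` is convex on a bounded
open convex set `O`, `w ≤ h` on `∂O`, and `|∂w(E)| ≥ λ ∫_E w^q` for all Borel `E ⊆ O`,
then `|O| ≤ C(n,q,λ) h^{(n−q)/2}`. -/
theorem volume_bound_sublevel
    (n : ℕ) (hn : 2 ≤ n) (q lam : ℝ) (hq0 : 0 ≤ q) (hqn : q < n) (hlam : 0 < lam) :
    ∃ C : ℝ, 0 < C ∧
      ∀ (h : ℝ) (O : Set (EuclideanSpace ℝ (Fin n))) (w : EuclideanSpace ℝ (Fin n) → ℝ),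
        0 < h →
        IsOpen O → Convex ℝ O → Bornology.IsBounded O →
        ContinuousOn w (closure O) → ConvexOn ℝ (closure O) w →
        (∀ x ∈ O, 0 < w x) →
        (∀ x ∈ frontier O, w x ≤ h) →
        (∀ E : Set (EuclideanSpace ℝ (Fin n)), MeasurableSet E → E ⊆ O →
          ENNReal.ofReal lam * ∫⁻ x in E, ENNReal.ofReal (w x ^ q) ≤
            volume (subgradImg O w E)) →
        volume O ≤ ENNReal.ofReal (C * h ^ (((n : ℝ) - q) / 2)) := by
  have hn0 : 0 < n := by omega
  have hnR : (0 : ℝ) < n := by exact_mod_cast hn0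
  have hnq : 0 < n - q := sub_pos.2 hqn
  obtain ⟨R, hRdef⟩ : ∃ R : ℝ, R = 1 / (4 * n) := ⟨_, rfl⟩
  obtain ⟨α, hαdef⟩ : ∃ α : ℝ, α = 2 * n / (n - q) := ⟨_, rfl⟩
  have hR : 0 < R := by rw [hRdef]; positivity
  have hα : 0 < α := by rw [hαdef]; positivity
  have hαn : α * (n - q) = 2 * n := by rw [hαdef]; field_simp
  set B := 2 * 16 ^ n * (2 ^ (α + 1)) ^ q * (2 / R ^ α) ^ (n - q) / lam with hB
  have hB0 : 0 < B := by positivity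
  refine ⟨2 ^ n * √B, by positivity, ?_⟩
  intro h O w hh hO hconv hbd hcont hw hpos hfr hmeas
  rcases O.eq_empty_or_nonempty with rfl | hne
  · simp
  have : Nonempty (Fin n) := ⟨⟨0, hn0⟩⟩
  obtain ⟨g, M, hM, hgO, hvol⟩ := exists_affine_box hn0 hO hconv hbd hne
  rw [← hRdef] at hgO
  have hwh : ∀ x ∈ O, w x ≤ h := fun x hx =>
    ConvexOn.le_of_le_frontier hO hbd hcont hw hfr x (subset_closure hx)
  have hwO : ConvexOn ℝ O w := hw.subset subset_closure hconv
  have hcO : ContinuousOn w O := hcont.mono subset_closure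
  have hTc : Continuous (Matrix.toEuclideanLin M) := LinearMap.continuous_of_finiteDimensional _
  have hΦ : ContinuousOn (fun c => w (g + Matrix.toEuclideanLin M c)) (box n R) :=
    hcO.comp (by fun_prop) hgO
  have hmono : ∀ {s t : ℝ}, s ≤ t → box n s ⊆ box n t := fun hst c hc i => (hc i).trans hst
  have hex : ∀ t : ℝ, ∃ c, t ∈ Ioc 0 R → c ∈ box n t ∧
      ∀ d ∈ box n t, w (g + Matrix.toEuclideanLin M d) ≤ w (g + Matrix.toEuclideanLin M c) := by
    intro t
    by_cases ht : t ∈ Ioc 0 R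
    · obtain ⟨c, hc, hmax⟩ := (isCompact_box n ht.1.le).exists_isMaxOn
        ⟨0, zero_mem_box n ht.1.le⟩ (hΦ.mono (hmono ht.2))
      exact ⟨c, fun _ => ⟨hc, fun d hd => hmax hd⟩⟩
    · exact ⟨0, fun h => absurd h ht⟩
  choose c hc using hex
  have hcmem : ∀ t ∈ Ioc 0 R, g + Matrix.toEuclideanLin M (c t) ∈ O := fun t ht =>
    hgO _ (hmono ht.2 (hc t ht).1)
  have hg : g + Matrix.toEuclideanLin M 0 ∈ O := hgO 0 (zero_mem_box n hR.le)
  obtain ⟨t, ht, hpow, hdouble⟩ := exists_doubling_scale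
    (m := fun t => w (g + Matrix.toEuclideanLin M (c t))) (hpos _ hg) hR hα
    fun t ht => ⟨(hc t ht).2 0 (zero_mem_box n ht.1.le), hwh _ (hcmem t ht)⟩
  have ht0 : 0 < t := ht.1
  have ht2 : t / 2 ∈ Ioc 0 R := ⟨by linarith, by linarith [ht.2]⟩
  have hs : 3 * t / 4 ≤ R := by linarith [ht.2]
  have hsO : ∀ d ∈ box n (3 * t / 4), g + Matrix.toEuclideanLin M d ∈ O := fun d hd =>
    hgO d (hmono hs hd)
  set D := (fun d => g + Matrix.toEuclideanLin M d) '' box n (3 * t / 4) with hD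
  have hDm : MeasurableSet D :=
    ((isCompact_box n (by positivity)).image (by fun_prop)).measurableSet
  have hupper := volume_subgradImg_le (O := O) (w := w) (g := g) hM
    (show 3 * t / 4 < t by linarith) (hpos _ (hcmem t ht)).le (fun d hd => hgO d (hmono ht.2 hd))
    (fun x hx => (hpos x hx).le) (hc t ht).2
  have hlower := rpow_mul_volume_le_setLIntegral hq0 (show t / 2 ≤ 3 * t / 4 by linarith) hsO
    (fun x hx => (hpos x hx).le) hcO hwO (hc _ ht2).1
  have hmid := hmeas D hDm (by rintro _ ⟨d, hd, rfl⟩; exact hsO d hd)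
  rw [← hD] at hupper hlower
  have hd : 0 < |M.det| := abs_pos.2 hM
  have hmt := hpos _ (hcmem t ht)
  have hmr := hpos _ (hcmem _ ht2)
  have hts : 0 < t - 3 * t / 4 := by linarith
  have hreal : lam * (w (g + Matrix.toEuclideanLin M (c (t / 2))) ^ q *
      (|M.det| * (2 * (3 * t / 4 - t / 2)) ^ n)) ≤
      2 * (|M.det|⁻¹ * (2 * (w (g + Matrix.toEuclideanLin M (c t)) / (t - 3 * t / 4))) ^ n) := by
    rw [← ENNReal.ofReal_le_ofReal_iff (by positivity), ENNReal.ofReal_mul hlam.le,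
      ENNReal.ofReal_mul zero_le_two, ENNReal.ofReal_ofNat]
    calc _ ≤ ENNReal.ofReal lam * (2 * ∫⁻ x in D, ENNReal.ofReal (w x ^ q)) := by gcongr
      _ = 2 * (ENNReal.ofReal lam * ∫⁻ x in D, ENNReal.ofReal (w x ^ q)) := by ring
      _ ≤ _ := by gcongr; exact hmid.trans hupper
  have hsq := sq_le_of_doubling_scale hq0 hqn hlam hR hαn hd ht0 hh hmr hmt hpow hdouble hreal
  rw [← hB] at hsq
  have hdet : |M.det| ≤ √B * h ^ ((n - q) / 2) := by
    refine le_of_sq_le_sq ?_ (by positivity)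
    rw [mul_pow, Real.sq_sqrt hB0.le, ← Real.rpow_natCast (h ^ _), ← Real.rpow_mul hh.le]
    simpa using hsq
  refine hvol.trans (ENNReal.ofReal_le_ofReal ?_)
  rw [mul_assoc]
  gcongr
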